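/- Let p ≥ 5 be a prime and let D be a nontrivial regular (8p^3, 4p^2+2p−2, 2p−2, 2p+2)-partial difference set in an Abelian group G of order 8p^3. Then the number of elements of order 2 in D is either 0 or 4. -/

import Mathlib

variable {G : Type*} [CommGroup G] [DecidableEq G] [Fintype G]

/-- The number of representations of `g` as `d₁ * d₂⁻¹` with `d₁, d₂ ∈ D`, `d₁ ≠ d₂`. -/
def pdsReps (D : Finset G) (g : G) : ℕ :=
  ((D ×ˢ D).filter (fun x => x.1 ≠ x.2 ∧ x.1 * x.2⁻¹ = g)).card

/-- `D` is a `(v,k,λ,μ)`-partial difference set in `G`. -/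
def IsPDS (D : Finset G) (v k l m : ℕ) : Prop :=
  Fintype.card G = v ∧ D.card = k ∧
  (∀ g : G, g ≠ 1 → g ∈ D → pdsReps D g = l) ∧
  (∀ g : G, g ≠ 1 → g ∉ D → pdsReps D g = m)

/-- `D` is regular: closed under inverses and not containing the identity. -/
def IsRegularPDS (D : Finset G) : Prop :=
  (∀ d ∈ D, d⁻¹ ∈ D) ∧ (1 : G) ∉ D

/-- A regular PDS is trivial if `D ∪ {e}` or `G \ D` is a subgroup. -/
def IsTrivialPDS (D : Finset G) : Prop :=
  (∃ H : Subgroup G, (H : Set G) = ↑D ∪ {1}) ∨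
  (∃ H : Subgroup G, (H : Set G) = (↑D : Set G)ᶜ)

section

open MonoidAlgebra Finset

/-- The number of preimages in `D` of `a` under `φ`, with the identity of `G` counted twice
in addition. -/
def fiberCount (D : Finset G) (φ : G →* G) (a : G) : ℕ :=
  #{d ∈ D | φ d = a} + if a = 1 then 2 else 0

/-- The image of `D + 2` under `φ` in the group algebra `R[G]`. -/
noncomputable def shiftedSum (R : Type*) [CommRing R] (D : Finset G) (φ : G →* G) :
    MonoidAlgebra R G :=
  ∑ d ∈ D, of R G (φ d) + 2

section GroupAlgebra

variable {R : Type*} [CommRing R]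

omit [Fintype G] in
lemma coeff_sum_of (S : Finset G) (φ : G →* G) (a : G) :
    (∑ d ∈ S, of R G (φ d)).coeff a = (#{d ∈ S | φ d = a} : R) := by
  simp [MonoidAlgebra.coeff_sum, Finsupp.finsetSum_apply, Finsupp.single_apply]

omit [Fintype G] in
lemma coeff_natCast_apply (n : ℕ) (a : G) :
    (n : MonoidAlgebra R G).coeff a = if a = 1 then (n : R) else 0 := by
  simp [MonoidAlgebra.natCast_def, Finsupp.single_apply, eq_comm]

omit [Fintype G] in
lemma coeff_shiftedSum (D : Finset G) (φ : G →* G) (a : G) :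
    (shiftedSum R D φ).coeff a = (fiberCount D φ a : R) := by
  have h := coeff_natCast_apply (R := R) 2 a
  rw [shiftedSum, MonoidAlgebra.coeff_add, Finsupp.add_apply, coeff_sum_of, fiberCount]
  push_cast at h ⊢
  rw [h]

omit [DecidableEq G] [Fintype G] in
lemma shiftedSum_pow (q n : ℕ) [Fact q.Prime] [CharP R q] (D : Finset G) :
    shiftedSum R D (MonoidHom.id G) ^ q ^ n = shiftedSum R D (powMonoidHom (q ^ n)) := by
  have : CharP (MonoidAlgebra R G) q :=
    charP_of_injective_ringHom (f := MonoidAlgebra.singleOneRingHom)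
      (fun a b h ↦ by simpa using congr(($h).coeff 1)) q
  have h2 : (2 : MonoidAlgebra R G) ^ q ^ n = 2 := by
    rw [← one_add_one_eq_two, add_pow_char_pow]
    simp
  rw [shiftedSum, add_pow_char_pow, sum_pow_char_pow, h2, shiftedSum]
  simp [MonoidAlgebra.single_pow]

omit [DecidableEq G] in
lemma shiftedSum_mul_sum (D : Finset G) :
    shiftedSum R D (MonoidHom.id G) * ∑ g : G, of R G g =
      ((#D + 2 : ℕ) : MonoidAlgebra R G) * ∑ g : G, of R G g := by
  have h (d : G) : of R G d * ∑ g : G, of R G g = ∑ g : G, of R G g := by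
    rw [Finset.mul_sum]
    simp_rw [← map_mul]
    exact Fintype.sum_bijective (d * ·) (Group.mulLeft_bijective d) _ _ fun _ ↦ rfl
  simp only [shiftedSum, add_mul, Finset.sum_mul, MonoidHom.id_apply, h]
  simp [add_mul]

lemma sum_pdsReps (D : Finset G) (φ : G →* G) (hinv : ∀ d ∈ D, d⁻¹ ∈ D) :
    (∑ d ∈ D, of R G (φ d)) ^ 2 =
      (#D : MonoidAlgebra R G) + ∑ g : G, (pdsReps D g : MonoidAlgebra R G) * of R G (φ g) := by
  have h1 : (∑ d ∈ D, of R G (φ d)) = ∑ d ∈ D, of R G (φ d⁻¹) :=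
    Finset.sum_bij' (fun d _ ↦ d⁻¹) (fun d _ ↦ d⁻¹) (by simpa using hinv) (by simpa using hinv)
      (by simp) (by simp) (by simp)
  have h2 : ∑ g : G, (pdsReps D g : MonoidAlgebra R G) * of R G (φ g) =
      ∑ x ∈ (D ×ˢ D).filter (fun x ↦ x.1 ≠ x.2), of R G (φ (x.1 * x.2⁻¹)) := by
    rw [← Finset.sum_fiberwise _ (fun x : G × G ↦ x.1 * x.2⁻¹)]
    refine Finset.sum_congr rfl fun g _ ↦ ?_
    rw [Finset.filter_filter, pdsReps, ← nsmul_eq_mul, ← Finset.sum_const]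
    refine Finset.sum_congr rfl fun x hx ↦ ?_
    rw [(Finset.mem_filter.1 hx).2.2]
  have h3 : (#D : MonoidAlgebra R G) =
      ∑ x ∈ (D ×ˢ D).filter (fun x ↦ ¬ x.1 ≠ x.2), of R G (φ (x.1 * x.2⁻¹)) := by
    simp only [not_not]
    rw [Finset.sum_congr rfl (g := fun _ ↦ (1 : MonoidAlgebra R G))]
    · simp [← Finset.diag_eq_filter]
    · intro x hx
      rw [(Finset.mem_filter.1 hx).2, mul_inv_cancel, map_one, map_one]
  rw [h2, h3, add_comm, Finset.sum_filter_add_sum_filter_not, sq]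
  nth_rewrite 2 [h1]
  rw [Finset.sum_mul_sum, ← Finset.sum_product']
  simp_rw [map_mul]

lemma shiftedSum_sq {p : ℕ} (hp : 1 ≤ p) {D : Finset G} (φ : G →* G)
    (hPDS : IsPDS D (8 * p ^ 3) (4 * p ^ 2 + 2 * p - 2) (2 * p - 2) (2 * p + 2))
    (hreg : IsRegularPDS D) :
    shiftedSum R D φ ^ 2 = 4 * (p : MonoidAlgebra R G) ^ 2 +
      (2 * (p : MonoidAlgebra R G) + 2) * ∑ g : G, of R G (φ g) := by
  obtain ⟨-, hk, hl, hm⟩ := hPDS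
  have h (g : G) : (pdsReps D g : MonoidAlgebra R G) * of R G (φ g) =
      (2 * (p : MonoidAlgebra R G) + 2) * of R G (φ g) - (if g ∈ D then 4 * of R G (φ g) else 0) -
        (if g = 1 then (2 * (p : MonoidAlgebra R G) + 2) * of R G (φ g) else 0) := by
    by_cases hg : g = 1
    · subst hg
      have : pdsReps D (1 : G) = 0 := by
        simp only [pdsReps, Finset.card_eq_zero, Finset.filter_eq_empty_iff]
        rintro x - ⟨h1, h2⟩
        exact h1 (mul_inv_eq_one.1 h2)
      simp [this, hreg.2]
    · by_cases hD : g ∈ D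
      · rw [hl g hg hD, Nat.cast_sub (by lia)]
        simp only [hD, hg, if_true, if_false]
        push_cast
        ring
      · rw [hm g hg hD]
        simp [hD, hg]
  have hk' : (#D : MonoidAlgebra R G) = 4 * (p : MonoidAlgebra R G) ^ 2 + 2 * p - 2 := by
    rw [hk, Nat.cast_sub (by nlinarith)]
    push_cast
    ring
  have hsq := sum_pdsReps (R := R) D φ hreg.1
  simp_rw [h] at hsq
  rw [Finset.sum_sub_distrib, Finset.sum_sub_distrib, ← Finset.sum_filter, ← Finset.sum_filter,
    ← Finset.mul_sum, ← Finset.mul_sum, hk', Finset.filter_mem_eq_inter, Finset.univ_inter,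
    Finset.filter_eq' univ (1 : G)] at hsq
  simp only [Finset.mem_univ, if_true, Finset.sum_singleton, map_one, mul_one] at hsq
  rw [shiftedSum]
  linear_combination hsq

end GroupAlgebra

section Multiplier

variable {p : ℕ} {D : Finset G}

omit [DecidableEq G] in
lemma shiftedSum_sq_mul_sum {R : Type*} [CommRing R] (D : Finset G) :
    shiftedSum R D (MonoidHom.id G) ^ 2 * ∑ g : G, of R G g =
      ((#D + 2 : ℕ) : MonoidAlgebra R G) ^ 2 * ∑ g : G, of R G g := by
  rw [sq, mul_assoc, shiftedSum_mul_sum, mul_left_comm, shiftedSum_mul_sum, sq, mul_assoc]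

lemma exists_shiftedSum_pow {R : Type*} [CommRing R] (hp : 1 ≤ p)
    (hPDS : IsPDS D (8 * p ^ 3) (4 * p ^ 2 + 2 * p - 2) (2 * p - 2) (2 * p + 2))
    (hreg : IsRegularPDS D) (m : ℕ) :
    ∃ c : ℕ, shiftedSum R D (MonoidHom.id G) ^ (2 * m + 1) =
      (((2 * p) ^ (2 * m) : ℕ) : MonoidAlgebra R G) * shiftedSum R D (MonoidHom.id G) +
        (c : MonoidAlgebra R G) * ∑ g : G, of R G g := by
  have hsq := shiftedSum_sq (R := R) hp (MonoidHom.id G) hPDS hreg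
  simp only [MonoidHom.id_apply] at hsq
  have h1 := shiftedSum_mul_sum (R := R) D
  have h2 := shiftedSum_sq_mul_sum (R := R) D
  induction m with
  | zero => exact ⟨0, by simp⟩
  | succ m ih =>
    obtain ⟨c, hc⟩ := ih
    refine ⟨(2 * p) ^ (2 * m) * (2 * p + 2) * (#D + 2) + c * (#D + 2) ^ 2, ?_⟩
    push_cast at hc h1 h2 ⊢
    have e : 2 * (m + 1) + 1 = (2 * m + 1) + 2 := by ring
    rw [e, pow_add, hc]
    linear_combination
      (2 * (p : MonoidAlgebra R G)) ^ (2 * m) * shiftedSum R D (MonoidHom.id G) * hsq +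
      (2 * (p : MonoidAlgebra R G)) ^ (2 * m) * (2 * (p : MonoidAlgebra R G) + 2) * h1 +
      c * h2

lemma prime_pow_mem_iff (hp : 1 ≤ p)
    (hPDS : IsPDS D (8 * p ^ 3) (4 * p ^ 2 + 2 * p - 2) (2 * p - 2) (2 * p + 2))
    (hreg : IsRegularPDS D) {q : ℕ} (hq : q.Prime) (hqp : q.Coprime (2 * p)) (g : G) :
    g ^ q ∈ D ↔ g ∈ D := by
  have : Fact q.Prime := ⟨hq⟩
  have hcop : (Nat.card G).Coprime q := by
    rw [Nat.card_eq_fintype_card, hPDS.1, show 8 * p ^ 3 = (2 * p) ^ 3 by ring]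
    exact (hqp.pow_right 3).symm
  have hinj (x y : G) : x ^ q = y ^ q ↔ x = y := (powCoprime hcop).injective.eq_iff
  have hinj_one (x : G) : x ^ q = 1 ↔ x = 1 := by simpa using hinj x 1
  have hq2 : q ≠ 2 := by
    rintro rfl
    rw [Nat.coprime_mul_iff_right] at hqp
    exact absurd hqp.1 (by decide)
  have hodd : q % 2 = 1 := hq.eq_two_or_odd.resolve_left hq2
  obtain ⟨m, rfl⟩ : ∃ m, q = 2 * m + 1 := ⟨q / 2, by lia⟩
  obtain ⟨c, hc⟩ := exists_shiftedSum_pow (R := ZMod (2 * m + 1)) hp hPDS hreg m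
  have hfrob := shiftedSum_pow (R := ZMod (2 * m + 1)) (2 * m + 1) 1 D
  rw [pow_one, hc] at hfrob
  have hfermat : (((2 * p) ^ (2 * m) : ℕ) : ZMod (2 * m + 1)) = 1 := by
    rw [Nat.cast_pow]
    refine ZMod.pow_card_sub_one_eq_one fun h ↦ ?_
    rw [ZMod.natCast_eq_zero_iff] at h
    exact hq.one_lt.ne' (Nat.eq_one_of_dvd_coprimes hqp dvd_rfl h)
  have hsum (a : G) : (∑ g : G, of (ZMod (2 * m + 1)) G g).coeff a = 1 := by
    have := coeff_sum_of (R := ZMod (2 * m + 1)) univ (MonoidHom.id G) a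
    simp only [MonoidHom.id_apply, Finset.filter_eq', Finset.mem_univ, if_true,
      Finset.card_singleton, Nat.cast_one] at this
    exact this
  have hcoeff (a : G) : (fiberCount D (MonoidHom.id G) a : ZMod (2 * m + 1)) + c =
      fiberCount D (powMonoidHom (2 * m + 1)) a := by
    have := congr(($hfrob).coeff a)
    rw [coeff_shiftedSum, MonoidAlgebra.coeff_add, Finsupp.add_apply, ← nsmul_eq_mul,
      ← nsmul_eq_mul, MonoidAlgebra.coeff_smul, MonoidAlgebra.coeff_smul, Finsupp.smul_apply,
      Finsupp.smul_apply, hsum, coeff_shiftedSum, nsmul_eq_mul, nsmul_eq_mul, hfermat] at this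
    simp at this
    exact this
  have hone : #{d ∈ D | d ^ (2 * m + 1) = 1} = 0 := by
    rw [Finset.card_eq_zero, Finset.filter_eq_empty_iff]
    intro d hd h
    exact hreg.2 ((hinj_one d).1 h ▸ hd)
  have hc0 : (c : ZMod (2 * m + 1)) = 0 := by
    simpa [fiberCount, hone, Finset.filter_eq', hreg.2] using hcoeff 1
  by_cases hg : g = 1
  · simp [hg]
  have hgq : g ^ (2 * m + 1) ≠ 1 := by rwa [Ne, hinj_one]
  have := hcoeff (g ^ (2 * m + 1))
  have : Nontrivial (ZMod (2 * m + 1)) := ZMod.nontrivial_iff.2 hq.one_lt.ne'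
  by_cases h1 : g ∈ D <;> by_cases h2 : g ^ (2 * m + 1) ∈ D <;>
    simp_all [fiberCount, Finset.filter_eq']

lemma pow_mem_iff (hp : 1 ≤ p)
    (hPDS : IsPDS D (8 * p ^ 3) (4 * p ^ 2 + 2 * p - 2) (2 * p - 2) (2 * p + 2))
    (hreg : IsRegularPDS D) {n : ℕ} (hn : n.Coprime (2 * p)) (g : G) :
    g ^ n ∈ D ↔ g ∈ D := by
  induction n using Nat.recOnMul generalizing g with
  | zero => simp at hn
  | one => simp
  | prime q hq => exact prime_pow_mem_iff hp hPDS hreg hq hn g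
  | mul a b iha ihb =>
    rw [pow_mul, ihb (hn.coprime_mul_left), iha (hn.coprime_mul_right)]

end Multiplier

omit [DecidableEq G] in
lemma zpowers_pow_eq_iff_coprime {x : G} {s : ℕ} :
    Subgroup.zpowers (x ^ s) = Subgroup.zpowers x ↔ (orderOf x).Coprime s := by
  constructor
  · intro h
    have h1 : orderOf (x ^ s) = orderOf x := by rw [← Nat.card_zpowers, h, Nat.card_zpowers]
    rw [orderOf_pow] at h1
    have h2 := Nat.div_mul_cancel (Nat.gcd_dvd_left (orderOf x) s)
    rw [h1] at h2
    exact Nat.eq_of_mul_eq_mul_left (orderOf_pos x) (by rw [h2, mul_one])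
  · intro h
    obtain ⟨m, hm⟩ := exists_pow_eq_self_of_coprime h.symm
    refine le_antisymm ?_ ?_ <;> rw [Subgroup.zpowers_le]
    · exact Subgroup.npow_mem_zpowers x s
    · exact Subgroup.mem_zpowers_iff.2 ⟨m, by rw [zpow_natCast, hm]⟩

open scoped Classical in
lemma card_filter_zpowers_eq (x : G) :
    #{y : G | Subgroup.zpowers y = Subgroup.zpowers x} = (orderOf x).totient := by
  rw [Nat.totient_eq_card_coprime]
  symm
  refine Finset.card_bij (fun s _ ↦ x ^ s) ?_ ?_ ?_
  · intro s hs
    simp only [Finset.mem_filter, Finset.mem_univ, true_and] at hs ⊢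
    exact zpowers_pow_eq_iff_coprime.2 hs.2
  · intro s hs t ht h
    simp only [Finset.mem_filter, Finset.mem_range] at hs ht
    exact pow_injOn_Iio_orderOf hs.1 ht.1 h
  · intro y hy
    simp only [Finset.mem_filter, Finset.mem_univ, true_and] at hy
    have hyx : y ∈ Subgroup.zpowers x := hy ▸ Subgroup.mem_zpowers y
    rw [mem_zpowers_iff_mem_range_orderOf, Finset.mem_image] at hyx
    obtain ⟨s, hs, rfl⟩ := hyx
    exact ⟨s, Finset.mem_filter.2 ⟨hs, zpowers_pow_eq_iff_coprime.1 hy⟩, rfl⟩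

open scoped Classical in
/-- A set of elements of `p`-power order which is closed under changing the generator of a
cyclic subgroup and avoids the identity has cardinality divisible by `p - 1`. -/
lemma sub_one_dvd_card {p : ℕ} (hp : p.Prime) (B : Finset G)
    (hord : ∀ x ∈ B, ∃ j, orderOf x = p ^ (j + 1))
    (hpow : ∀ x ∈ B, ∀ s : ℕ, s.Coprime p → x ^ s ∈ B) : p - 1 ∣ #B := by
  rw [Finset.card_eq_sum_card_image (fun x ↦ Subgroup.zpowers x) B]
  refine Finset.dvd_sum fun H hH ↦ ?_
  obtain ⟨x, hx, rfl⟩ := Finset.mem_image.1 hH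
  obtain ⟨j, hj⟩ := hord x hx
  have : (B.filter fun y ↦ Subgroup.zpowers y = Subgroup.zpowers x) =
      ({y : G | Subgroup.zpowers y = Subgroup.zpowers x} : Finset G) := by
    ext y
    simp only [Finset.mem_filter, Finset.mem_univ, true_and, and_iff_right_iff_imp]
    intro hy
    have hyx : y ∈ Subgroup.zpowers x := hy ▸ Subgroup.mem_zpowers y
    rw [mem_zpowers_iff_mem_range_orderOf, Finset.mem_image] at hyx
    obtain ⟨s, -, rfl⟩ := hyx
    refine hpow x hx s ?_
    have hs := zpowers_pow_eq_iff_coprime.1 hy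
    rw [hj] at hs
    exact ((Nat.coprime_pow_left_iff (Nat.succ_pos j) _ _).1 hs).symm
  rw [this, card_filter_zpowers_eq, hj, Nat.totient_prime_pow_succ hp]
  exact dvd_mul_left _ _

section PowFibers

variable {p : ℕ} {D : Finset G}

lemma sum_fiberCount (D : Finset G) (φ : G →* G) : ∑ a : G, fiberCount D φ a = #D + 2 := by
  simp only [fiberCount, Finset.sum_add_distrib]
  rw [← Finset.card_eq_sum_card_fiberwise (fun _ _ ↦ Finset.mem_coe.2 (Finset.mem_univ _))]
  simp

omit [Fintype G] in
lemma fiberCount_inv (φ : G →* G) (hinv : ∀ d ∈ D, d⁻¹ ∈ D) (a : G) :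
    fiberCount D φ a⁻¹ = fiberCount D φ a := by
  have : #{d ∈ D | φ d = a⁻¹} = #{d ∈ D | φ d = a} := by
    refine Finset.card_bij' (fun d _ ↦ d⁻¹) (fun d _ ↦ d⁻¹) ?_ ?_ (by simp) (by simp)
    · intro d hd
      rw [Finset.mem_filter] at hd ⊢
      exact ⟨hinv d hd.1, by rw [map_inv, hd.2, inv_inv]⟩
    · intro d hd
      rw [Finset.mem_filter] at hd ⊢
      exact ⟨hinv d hd.1, by rw [map_inv, hd.2]⟩
  simp [fiberCount, this]

lemma sum_fiberCount_sq (hp : 1 ≤ p) (φ : G →* G)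
    (hPDS : IsPDS D (8 * p ^ 3) (4 * p ^ 2 + 2 * p - 2) (2 * p - 2) (2 * p + 2))
    (hreg : IsRegularPDS D) :
    ∑ a : G, fiberCount D φ a ^ 2 = 4 * p ^ 2 + (2 * p + 2) * #{g : G | φ g = 1} := by
  have h := congr(($(shiftedSum_sq (R := ℤ) hp φ hPDS hreg)).coeff 1)
  have e1 : 4 * (p : MonoidAlgebra ℤ G) ^ 2 = ((4 * p ^ 2 : ℕ) : MonoidAlgebra ℤ G) := by
    push_cast
    ring
  have e2 : 2 * (p : MonoidAlgebra ℤ G) + 2 = ((2 * p + 2 : ℕ) : MonoidAlgebra ℤ G) := by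
    push_cast
    ring
  rw [sq, coeff_mul_apply_left, Finsupp.sum_fintype _ _ (by simp), e1, e2,
    MonoidAlgebra.coeff_add, Finsupp.add_apply, coeff_natCast_apply, ← nsmul_eq_mul,
    MonoidAlgebra.coeff_smul, Finsupp.smul_apply, coeff_sum_of, if_pos rfl] at h
  simp only [coeff_shiftedSum, mul_one, fiberCount_inv φ hreg.1, nsmul_eq_mul, ← sq] at h
  exact_mod_cast h

lemma dvd_fiberCount (hp : p.Prime)
    (hPDS : IsPDS D (8 * p ^ 3) (4 * p ^ 2 + 2 * p - 2) (2 * p - 2) (2 * p + 2))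
    (hreg : IsRegularPDS D) (a : G) : p ∣ fiberCount D (powMonoidHom (p ^ 4)) a := by
  have : Fact p.Prime := ⟨hp⟩
  have hp0 : (p : MonoidAlgebra (ZMod p) G) = 0 := by
    rw [← map_natCast (MonoidAlgebra.singleOneRingHom : ZMod p →+* MonoidAlgebra (ZMod p) G)]
    simp
  have hk : #D + 2 = p * (4 * p + 2) := by
    have h2 := hp.two_le
    have : 4 ≤ 4 * p ^ 2 := by nlinarith
    rw [hPDS.2.1]
    have : 4 * p ^ 2 + 2 * p - 2 + 2 = 4 * p ^ 2 + 2 * p := by lia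
    rw [this]
    ring
  have hsq := shiftedSum_sq (R := ZMod p) hp.one_le (MonoidHom.id G) hPDS hreg
  have hmul := shiftedSum_sq_mul_sum (R := ZMod p) D
  rw [hk] at hmul
  push_cast at hmul
  simp only [MonoidHom.id_apply, hp0] at hsq hmul
  have h4 : shiftedSum (ZMod p) D (MonoidHom.id G) ^ 4 = 0 := by
    linear_combination shiftedSum (ZMod p) D (MonoidHom.id G) ^ 2 * hsq + 2 * hmul
  have hz : shiftedSum (ZMod p) D (powMonoidHom (p ^ 4)) = 0 := by
    rw [← shiftedSum_pow]
    exact pow_eq_zero_of_le (Nat.lt_pow_self hp.one_lt).le h4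
  rw [← CharP.cast_eq_zero_iff (ZMod p) p, ← coeff_shiftedSum, hz]
  simp

lemma pow_four_modEq_one_of_odd (hp : Odd p) : p ^ 4 ≡ 1 [MOD 8] := by
  have h := Nat.odd_iff.1 hp
  have : p % 8 = 1 ∨ p % 8 = 3 ∨ p % 8 = 5 ∨ p % 8 = 7 := by lia
  rcases this with h | h | h | h <;> simp [Nat.ModEq, Nat.pow_mod, h]

omit [DecidableEq G] [Fintype G] in
lemma pow_eq_self_of_modEq_one {a : G} {m n : ℕ} (ha : a ^ m = 1) (hn : n ≡ 1 [MOD m]) :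
    a ^ n = a := by
  have := pow_eq_pow_iff_modEq.2 (hn.of_dvd (orderOf_dvd_of_pow_eq_one ha))
  rwa [pow_one] at this

lemma coprime_card_of_forall_pow_eq_one {H : Type*} [Group H] [Finite H] {m n : ℕ}
    (hm : ∀ x : H, x ^ m = 1) (hmn : m.Coprime n) : (Nat.card H).Coprime n := by
  refine Nat.coprime_of_dvd fun q hq hqH hqn ↦ ?_
  have : Fact q.Prime := ⟨hq⟩
  obtain ⟨x, hx⟩ := exists_prime_orderOf_dvd_card' q hqH
  exact hq.one_lt.ne' (Nat.eq_one_of_dvd_coprimes hmn (hx ▸ orderOf_dvd_of_pow_eq_one (hm x)) hqn)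

lemma card_pow_eq_one (hp : 0 < p) (hodd : Odd p) (hG : Fintype.card G = 8 * p ^ 3) :
    #{a : G | a ^ 8 = 1} = 8 ∧ #{g : G | g ^ p ^ 4 = 1} = p ^ 3 := by
  have hcard (g : G) : g ^ (p ^ 4 * 8) = 1 := by
    rw [show p ^ 4 * 8 = Fintype.card G * p by rw [hG]; ring, pow_mul, pow_card_eq_one, one_pow]
  have hcop (n : ℕ) : Nat.Coprime 8 (p ^ n) :=
    Nat.Coprime.pow 3 n (Nat.coprime_two_left.2 hodd)
  have hprod : Nat.card (powMonoidHom (p ^ 4) : G →* G).range *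
      Nat.card (powMonoidHom (p ^ 4) : G →* G).ker = 8 * p ^ 3 := by
    rw [← Subgroup.index_ker, mul_comm, Subgroup.card_mul_index, Nat.card_eq_fintype_card, hG]
  have hrange : Nat.card (powMonoidHom (p ^ 4) : G →* G).range = #{a : G | a ^ 8 = 1} := by
    refine Nat.subtype_card _ fun a ↦ ?_
    simp only [Finset.mem_filter, Finset.mem_univ, true_and, MonoidHom.mem_range,
      powMonoidHom_apply]
    constructor
    · intro h
      exact ⟨a, pow_eq_self_of_modEq_one h (pow_four_modEq_one_of_odd hodd)⟩
    · rintro ⟨g, rfl⟩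
      rw [← pow_mul, hcard]
  have hker : Nat.card (powMonoidHom (p ^ 4) : G →* G).ker = #{g : G | g ^ p ^ 4 = 1} :=
    Nat.subtype_card _ fun a ↦ by simp [MonoidHom.mem_ker]
  have hrange_dvd : Nat.card (powMonoidHom (p ^ 4) : G →* G).range ∣ 8 := by
    refine Nat.Coprime.dvd_of_dvd_mul_right ?_ (Dvd.intro _ hprod)
    refine coprime_card_of_forall_pow_eq_one (m := 8) ?_ (hcop 3)
    rintro ⟨-, g, rfl⟩
    ext
    simp [← pow_mul, hcard]
  have hker_dvd : Nat.card (powMonoidHom (p ^ 4) : G →* G).ker ∣ p ^ 3 := by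
    refine Nat.Coprime.dvd_of_dvd_mul_left ?_ (Dvd.intro_left _ hprod)
    refine coprime_card_of_forall_pow_eq_one (m := p ^ 4) ?_ (hcop 4).symm
    rintro ⟨g, hg⟩
    ext
    simpa [MonoidHom.mem_ker] using hg
  rw [hrange, hker] at hprod
  rw [hrange] at hrange_dvd
  rw [hker] at hker_dvd
  have h8 := Nat.le_of_dvd (by norm_num) hrange_dvd
  have h3 := Nat.le_of_dvd (pow_pos hp 3) hker_dvd
  have := pow_pos hp 3
  constructor <;> nlinarith

lemma fiberCount_eq_zero (hG : Fintype.card G = 8 * p ^ 3) {a : G} (ha : a ^ 8 ≠ 1) :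
    fiberCount D (powMonoidHom (p ^ 4)) a = 0 := by
  have h1 : a ≠ 1 := by
    rintro rfl
    simp at ha
  simp only [fiberCount, h1, if_false, add_zero, Finset.card_eq_zero,
    Finset.filter_eq_empty_iff, powMonoidHom_apply]
  rintro d - rfl
  rw [← pow_mul, show p ^ 4 * 8 = Fintype.card G * p by rw [hG]; ring, pow_mul, pow_card_eq_one,
    one_pow] at ha
  exact ha rfl

lemma exists_fiberCount_eq (hp : p.Prime) (hodd : Odd p)
    (hPDS : IsPDS D (8 * p ^ 3) (4 * p ^ 2 + 2 * p - 2) (2 * p - 2) (2 * p + 2))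
    (hreg : IsRegularPDS D) {a : G} (ha : a ^ 8 = 1) :
    ∃ k, fiberCount D (powMonoidHom (p ^ 4)) a =
      (if a ∈ D then 1 else 0) + (if a = 1 then 2 else 0) + (p - 1) * k := by
  have hap : a ^ p ^ 4 = a := pow_eq_self_of_modEq_one ha (pow_four_modEq_one_of_odd hodd)
  set B : Finset G := {x : G | (x ≠ 1 ∧ x ^ p ^ 4 = 1) ∧ a * x ∈ D} with hB
  have hdvd : p - 1 ∣ #B := by
    refine sub_one_dvd_card hp B (fun x hx ↦ ?_) (fun x hx s hs ↦ ?_)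
    · simp only [hB, Finset.mem_filter, Finset.mem_univ, true_and] at hx
      obtain ⟨j, -, hj⟩ := (Nat.dvd_prime_pow hp).1 (orderOf_dvd_of_pow_eq_one hx.1.2)
      cases j with
      | zero => exact absurd (orderOf_eq_one_iff.1 (by simpa using hj)) hx.1.1
      | succ j => exact ⟨j, hj⟩
    · simp only [hB, Finset.mem_filter, Finset.mem_univ, true_and] at hx ⊢
      obtain ⟨⟨hx1, hxp⟩, hxD⟩ := hx
      refine ⟨⟨fun h ↦ hx1 ?_, by rw [pow_right_comm, hxp, one_pow]⟩, ?_⟩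
      · rw [← orderOf_eq_one_iff]
        exact Nat.eq_one_of_dvd_coprimes (hs.pow_right 4) (orderOf_dvd_of_pow_eq_one h)
          (orderOf_dvd_of_pow_eq_one hxp)
      · obtain ⟨n, hn8, hnp⟩ := Nat.chineseRemainder
          (Nat.Coprime.pow 3 4 (Nat.coprime_two_left.2 hodd)) 1 s
        have hn : n.Coprime (2 * p) := by
          refine Nat.Coprime.mul_right ?_ ?_
          · exact (Nat.coprime_two_right).2 (Nat.odd_iff.2 (hn8.of_dvd (by norm_num)))
          · have := (hnp.of_dvd (dvd_pow_self p (by norm_num))).gcd_eq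
            rw [Nat.Coprime, this]
            exact hs
        have hxs : x ^ s = x ^ n :=
          pow_eq_pow_iff_modEq.2 (hnp.symm.of_dvd (orderOf_dvd_of_pow_eq_one hxp))
        have han : a ^ n = a := pow_eq_self_of_modEq_one ha hn8
        rw [hxs]
        nth_rewrite 1 [← han]
        rwa [← mul_pow, pow_mem_iff hp.one_le hPDS hreg hn]
  obtain ⟨k, hk⟩ := hdvd
  refine ⟨k, ?_⟩
  have hsplit : #{d ∈ D | d ^ p ^ 4 = a} = (if a ∈ D then 1 else 0) + #B := by
    rw [← Finset.card_filter_add_card_filter_not (s := {d ∈ D | d ^ p ^ 4 = a}) (fun d ↦ d = a),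
      Finset.filter_filter, Finset.filter_filter]
    congr 1
    · have : D.filter (fun d ↦ d ^ p ^ 4 = a ∧ d = a) = if a ∈ D then {a} else ∅ := by
        rw [← Finset.filter_eq']
        refine Finset.filter_congr fun d _ ↦ ?_
        exact ⟨And.right, fun h ↦ ⟨by rw [h, hap], h⟩⟩
      rw [this]
      split_ifs <;> simp
    · refine Finset.card_bij' (fun d _ ↦ a⁻¹ * d) (fun x _ ↦ a * x) ?_ ?_ (by simp) (by simp)
      · intro d hd
        simp only [hB, Finset.mem_filter, Finset.mem_univ, true_and] at hd ⊢
        refine ⟨⟨fun h ↦ hd.2.2 (inv_mul_eq_one.1 h).symm, ?_⟩, by simpa using hd.1⟩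
        rw [mul_pow, inv_pow, hap, hd.2.1, inv_mul_cancel]
      · intro x hx
        simp only [hB, Finset.mem_filter, Finset.mem_univ, true_and] at hx ⊢
        refine ⟨hx.2, by rw [mul_pow, hap, hx.1.2, mul_one], fun h ↦ hx.1.1 ?_⟩
        simpa using h
  simp only [fiberCount, powMonoidHom_apply, hsplit, hk]
  ring

end PowFibers

/-- Eight natural numbers with the given sum and sum of squares are close to their mean. -/
lemma bounds_of_sum_of_sum_sq {ι : Type*} {S : Finset ι} (hS : #S = 8) {X : ι → ℕ} {p : ℕ}
    (hsum : ∑ i ∈ S, X i = 4 * p + 2) (hsq : ∑ i ∈ S, X i ^ 2 = 2 * p ^ 2 + 2 * p + 4)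
    {i : ι} (hi : i ∈ S) : 2 * p ≤ 4 * X i + 6 ∧ 4 * X i ≤ 2 * p + 8 := by
  classical
  have hcs := sq_sum_le_card_mul_sum_sq (s := S.erase i) (f := fun j ↦ (X j : ℤ))
  rw [Finset.card_erase_of_mem hi, hS] at hcs
  have h1 := Finset.add_sum_erase S (fun j ↦ (X j : ℤ)) hi
  have h2 := Finset.add_sum_erase S (fun j ↦ (X j : ℤ) ^ 2) hi
  zify at hsum hsq
  rw [hsum] at h1
  rw [hsq] at h2
  rw [← eq_sub_iff_add_eq'] at h1 h2
  rw [h1, h2] at hcs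
  push_cast at hcs
  have : (4 * (X i : ℤ) - (2 * p + 1)) ^ 2 ≤ 7 ^ 2 := by linarith
  have := abs_le_of_sq_le_sq' this (by norm_num)
  lia

lemma false_of_sums {ι : Type*} [DecidableEq ι] {S : Finset ι} (hS : #S = 8) {X : ι → ℕ} {p : ℕ}
    (hp5 : 5 ≤ p) (hodd : Odd p)
    (hsum : ∑ i ∈ S, X i = 4 * p + 2) (hsq : ∑ i ∈ S, X i ^ 2 = 2 * p ^ 2 + 2 * p + 4)
    {e : ι} (he : e ∈ S) (hXe : X e ≡ 2 [MOD p - 1])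
    (hX : ∀ i ∈ S, i ≠ e → X i ≡ 0 [MOD p - 1] ∨ X i ≡ 1 [MOD p - 1]) : False := by
  have hbound (i : ι) (hi : i ∈ S) := bounds_of_sum_of_sum_sq hS hsum hsq hi
  obtain ⟨r, rfl⟩ := hodd
  rw [Nat.add_sub_cancel] at hXe hX
  obtain rfl | hr : r = 2 ∨ 3 ≤ r := by lia
  · have hmod : ∀ i ∈ S.erase e, X i ≡ 1 [MOD 3] := by
      intro i hi
      rw [Finset.mem_erase] at hi
      have hb := hbound i hi.2
      have hx := hX i hi.2 hi.1
      simp only [Nat.ModEq] at hx ⊢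
      lia
    have he3 : X e ≡ 2 [MOD 3] := by
      have hb := hbound e he
      simp only [Nat.ModEq] at hXe ⊢
      lia
    have h := he3.add (Nat.ModEq.sum hmod)
    rw [Finset.add_sum_erase S X he, hsum, Finset.sum_const, Finset.card_erase_of_mem he, hS] at h
    simp [Nat.ModEq] at h
  · obtain ⟨i, hi, hie⟩ := Finset.exists_mem_ne (by rw [hS]; norm_num) e
    have hb := hbound i hi
    have hlt : X i < 2 * r := by lia
    rcases hX i hi hie with h | h
    · have := Nat.ModEq.eq_of_lt_of_lt h hlt (by lia)
      lia
    · have := Nat.ModEq.eq_of_lt_of_lt h hlt (by lia)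
      lia

/-- There is no regular `(8p^3, 4p^2+2p-2, 2p-2, 2p+2)`-PDS in an abelian group for `p ≥ 5`. -/
theorem not_isRegularPDS {p : ℕ} (hp : p.Prime) (hp5 : 5 ≤ p) {D : Finset G}
    (hPDS : IsPDS D (8 * p ^ 3) (4 * p ^ 2 + 2 * p - 2) (2 * p - 2) (2 * p + 2)) :
    ¬ IsRegularPDS D := by
  intro hreg
  have hodd : Odd p := hp.odd_of_ne_two (by lia)
  obtain ⟨hS, hK⟩ := card_pow_eq_one hp.pos hodd hPDS.1
  choose X hX using dvd_fiberCount hp hPDS hreg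
  have hrestrict (n : ℕ) (hn : n ≠ 0) : ∑ a ∈ ({a : G | a ^ 8 = 1} : Finset G), (p * X a) ^ n =
      ∑ a : G, fiberCount D (powMonoidHom (p ^ 4)) a ^ n := by
    rw [Finset.sum_filter]
    refine Finset.sum_congr rfl fun a _ ↦ ?_
    split_ifs with ha
    · rw [hX]
    · rw [fiberCount_eq_zero hPDS.1 ha, zero_pow hn]
  have hk : #D + 2 = p * (4 * p + 2) := by
    have : 4 ≤ 4 * p ^ 2 := by nlinarith
    have : 4 * p ^ 2 + 2 * p - 2 + 2 = 4 * p ^ 2 + 2 * p := by lia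
    rw [hPDS.2.1, this]
    ring
  have hmod (a : G) (ha : a ^ 8 = 1) :
      X a ≡ (if a ∈ D then 1 else 0) + (if a = 1 then 2 else 0) [MOD p - 1] := by
    obtain ⟨k, hk⟩ := exists_fiberCount_eq hp hodd hPDS hreg ha
    have hp1 : p ≡ 1 [MOD p - 1] := ((Nat.modEq_iff_dvd' hp.one_le).2 dvd_rfl).symm
    calc X a ≡ p * X a [MOD p - 1] := by simpa using (hp1.mul_right (X a)).symm
      _ = (if a ∈ D then 1 else 0) + (if a = 1 then 2 else 0) + (p - 1) * k := by rw [← hX, hk]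
      _ ≡ (if a ∈ D then 1 else 0) + (if a = 1 then 2 else 0) [MOD p - 1] := by
        simp [Nat.ModEq]
  refine false_of_sums (X := X) (e := 1) hS hp5 hodd ?_ ?_ (by simp) ?_ ?_
  · have h := hrestrict 1 one_ne_zero
    simp only [pow_one] at h
    rw [sum_fiberCount, hk, ← Finset.mul_sum] at h
    exact Nat.eq_of_mul_eq_mul_left hp.pos h
  · have h := hrestrict 2 two_ne_zero
    simp only [mul_pow] at h
    rw [sum_fiberCount_sq hp.one_le _ hPDS hreg, ← Finset.mul_sum] at h
    simp only [powMonoidHom_apply] at h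
    rw [hK] at h
    refine Nat.eq_of_mul_eq_mul_left (pow_pos hp.pos 2) (h.trans ?_)
    ring
  · simpa [hreg.2] using hmod 1 (one_pow 8)
  · intro a ha ha1
    have h := hmod a (by simpa using ha)
    rw [if_neg ha1, add_zero] at h
    split_ifs at h
    · exact Or.inr h
    · exact Or.inl h

end

/-- A nontrivial regular `(8p^3, 4p^2+2p-2, 2p-2, 2p+2)`-PDS contains either
`0` or `4` elements of order `2`. -/
theorem pds_case1_involutions (p : ℕ) (hp : p.Prime) (hp5 : 5 ≤ p)
    {G : Type*} [CommGroup G] [DecidableEq G] [Fintype G]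
    (D : Finset G)
    (hPDS : IsPDS D (8 * p ^ 3) (4 * p ^ 2 + 2 * p - 2) (2 * p - 2) (2 * p + 2))
    (hreg : IsRegularPDS D) (hnt : ¬ IsTrivialPDS D) :
    (D.filter (fun x => orderOf x = 2)).card = 0 ∨
      (D.filter (fun x => orderOf x = 2)).card = 4 := by
  exact absurd hreg (not_isRegularPDS hp hp5 hPDS)
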